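/- arXiv:1503.08571 — 3 statements merged into one kernel-verified Lean document; each statement's English description precedes it below -/
import Mathlib

section
/- Let (l, k, b) be a suspension triplet for (X_A, σ_A) and c = l − k. If c' ∈ C(X_A, ℤ) satisfies [c] = [c'] in H^A, then there exists a suspension triplet (l', k', b') for (X_A, σ_A) with c' = l' − k' and a homeomorphism Φ : S_{A,b}^{l,k} → S_{A,b'}^{l',k'} satisfying Φ∘b_A = b'_A (where b_A(x) = [x, b(x)] and b'_A(x) = [x, b'(x)] are the base maps) and Φ∘φ_{A,t} = φ_{A,t}∘Φ for all t ≥ 0. -/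
open scoped BigOperators NNReal

namespace OneSidedMarkov

variable {N M : ℕ}

/-- The matrix has entries in `{0, 1}`. -/
def IsZeroOne (A : Matrix (Fin N) (Fin N) ℤ) : Prop := ∀ i j, A i j = 0 ∨ A i j = 1

/-- The matrix is irreducible. -/
def IsIrreducible (A : Matrix (Fin N) (Fin N) ℤ) : Prop :=
  ∀ i j, ∃ m : ℕ, 0 < m ∧ (A ^ m) i j ≠ 0

/-- The matrix is a permutation matrix. -/
def IsPermutationMatrix (A : Matrix (Fin N) (Fin N) ℤ) : Prop :=
  ∃ e : Equiv.Perm (Fin N), ∀ i j, A i j = if e i = j then 1 else 0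

/-- The one-sided topological Markov shift space `X_A`. -/
abbrev Space (A : Matrix (Fin N) (Fin N) ℤ) : Type :=
  {x : ℕ → Fin N // ∀ n, A (x n) (x (n + 1)) = 1}

/-- The shift map `σ_A`. -/
def shift (A : Matrix (Fin N) (Fin N) ℤ) (x : Space A) : Space A :=
  ⟨fun n => x.1 (n + 1), fun n => x.2 (n + 1)⟩

lemma continuous_shift (A : Matrix (Fin N) (Fin N) ℤ) : Continuous (shift A) := by
  apply Continuous.subtype_mk
  exact continuous_pi fun n => (continuous_apply (n + 1)).comp continuous_subtype_val

/-- The shift map as a continuous map. -/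
def shiftMap (A : Matrix (Fin N) (Fin N) ℤ) : C(Space A, Space A) :=
  ⟨shift A, continuous_shift A⟩

/-- The coboundary subgroup `{ g - g ∘ σ_A }` of `C(X_A, ℤ)`. -/
def cobdySubgroup (A : Matrix (Fin N) (Fin N) ℤ) : AddSubgroup C(Space A, ℤ) :=
  AddSubgroup.closure {f | ∃ g : C(Space A, ℤ), f = g - g.comp (shiftMap A)}

/-- The ordered cohomology group `H^A = C(X_A, ℤ)/{g - g∘σ_A}`. -/
abbrev Coh (A : Matrix (Fin N) (Fin N) ℤ) : Type :=
  C(Space A, ℤ) ⧸ cobdySubgroup A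

/-- The class `[f] ∈ H^A`. -/
def cohClass (A : Matrix (Fin N) (Fin N) ℤ) (f : C(Space A, ℤ)) : Coh A :=
  QuotientAddGroup.mk f

/-- The positive cone `H^A_+`. -/
def CohPos (A : Matrix (Fin N) (Fin N) ℤ) : Set (Coh A) :=
  {c | ∃ f : C(Space A, ℤ), (∀ x, 0 ≤ f x) ∧ c = cohClass A f}

/-- `u` is an order unit of `(H^A, H^A_+)`. -/
def IsOrderUnit (A : Matrix (Fin N) (Fin N) ℤ) (u : Coh A) : Prop :=
  u ∈ CohPos A ∧ ∀ g : Coh A, ∃ n : ℕ, 0 < n ∧ n • u - g ∈ CohPos A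

/-- The data `(l, k, b)` of a suspension. -/
structure SuspData (A : Matrix (Fin N) (Fin N) ℤ) where
  l : C(Space A, ℝ)
  k : C(Space A, ℝ)
  b : C(Space A, ℝ)

/-- `c = l - k`. -/
def cFun {A : Matrix (Fin N) (Fin N) ℤ} (T : SuspData A) (x : Space A) : ℝ :=
  T.l x - T.k x

/-- `(l, k, b)` is a suspension triplet for `(X_A, σ_A)`. -/
def IsSuspTriplet {A : Matrix (Fin N) (Fin N) ℤ} (T : SuspData A) : Prop :=
  (∀ x, 0 ≤ T.l x) ∧ (∀ x, 0 ≤ T.k x) ∧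
  (∃ c : C(Space A, ℤ), (∀ x, (c x : ℝ) = cFun T x) ∧ IsOrderUnit A (cohClass A c)) ∧
  (∀ x, ∃ m : ℕ, T.l x - T.b x = m) ∧
  (∀ x, ∃ m : ℕ, T.k x - T.b (shift A x) = m)

/-- The space `X_{A,b}^ℝ = {(x, r) : r ≥ b(x)}`. -/
abbrev BaseSpace {A : Matrix (Fin N) (Fin N) ℤ} (T : SuspData A) : Type :=
  {p : Space A × ℝ // T.b p.1 ≤ p.2}

/-- The elementary relation `(x, r) ∼ (σ_A(x), r - c(x))` for `r ≥ l(x)`. -/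
def SuspRel {A : Matrix (Fin N) (Fin N) ℤ} (T : SuspData A)
    (p q : BaseSpace T) : Prop :=
  T.l p.1.1 ≤ p.1.2 ∧ q.1 = (shift A p.1.1, p.1.2 - cFun T p.1.1)

/-- The equivalence relation `∼_{l,k}` generated by `SuspRel`. -/
def suspSetoid {A : Matrix (Fin N) (Fin N) ℤ} (T : SuspData A) : Setoid (BaseSpace T) :=
  ⟨Relation.EqvGen (SuspRel T), Relation.EqvGen.is_equivalence _⟩

/-- The one-sided suspension `S_{A,b}^{l,k}` with the quotient topology. -/
abbrev Susp {A : Matrix (Fin N) (Fin N) ℤ} (T : SuspData A) : Type :=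
  Quotient (suspSetoid T)

/-- The class `[x, r]`. -/
def mkSusp {A : Matrix (Fin N) (Fin N) ℤ} (T : SuspData A) (p : BaseSpace T) : Susp T :=
  Quotient.mk (suspSetoid T) p

/-- The base map `x ↦ [x, b(x)]`. -/
def basePoint {A : Matrix (Fin N) (Fin N) ℤ} (T : SuspData A) (x : Space A) : Susp T :=
  mkSusp T ⟨(x, T.b x), le_refl _⟩

/-- Translation by `t ≥ 0` on `X_{A,b}^ℝ`. -/
def shiftPt {A : Matrix (Fin N) (Fin N) ℤ} (T : SuspData A) (t : ℝ≥0)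
    (p : BaseSpace T) : BaseSpace T :=
  ⟨(p.1.1, p.1.2 + t), le_trans p.2 (le_add_of_nonneg_right t.2)⟩

lemma suspRel_shiftPt {A : Matrix (Fin N) (Fin N) ℤ} (T : SuspData A) (t : ℝ≥0)
    {p q : BaseSpace T} (h : SuspRel T p q) : SuspRel T (shiftPt T t p) (shiftPt T t q) := by
  obtain ⟨h1, h2⟩ := h
  refine ⟨le_trans h1 (le_add_of_nonneg_right t.2), ?_⟩
  show (q.1.1, q.1.2 + (t : ℝ)) = _
  rw [h2]
  show (shift A p.1.1, p.1.2 - cFun T p.1.1 + (t : ℝ))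
      = (shift A p.1.1, p.1.2 + (t : ℝ) - cFun T p.1.1)
  congr 1
  ring

lemma eqvGen_map {α : Type*} {r r' : α → α → Prop} (f : α → α)
    (hf : ∀ a b, r a b → r' (f a) (f b)) :
    ∀ a b, Relation.EqvGen r a b → Relation.EqvGen r' (f a) (f b) := by
  intro a b h
  induction h with
  | rel a b hab => exact Relation.EqvGen.rel _ _ (hf a b hab)
  | refl a => exact Relation.EqvGen.refl _
  | symm a b _ ih => exact Relation.EqvGen.symm _ _ ih
  | trans a b c _ _ ih1 ih2 => exact Relation.EqvGen.trans _ _ _ ih1 ih2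

/-- The flow `φ_{A,t}([x, r]) = [x, r + t]`, `t ∈ ℝ_+`, on the one-sided suspension. -/
def flow {A : Matrix (Fin N) (Fin N) ℤ} (T : SuspData A) (t : ℝ≥0) :
    Susp T → Susp T :=
  Quotient.map' (shiftPt T t)
    (fun p q h => eqvGen_map (shiftPt T t) (fun _ _ hr => suspRel_shiftPt T t hr) p q h)

/-- The standard suspension data `(1, 0, 0)`. -/
def stdData (A : Matrix (Fin N) (Fin N) ℤ) : SuspData A := ⟨1, 0, 0⟩

/-- The standard one-sided suspension `S_A^1`. -/
abbrev StdSusp (A : Matrix (Fin N) (Fin N) ℤ) : Type := Susp (stdData A)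

/-- The standard base map `s_A(x) = [x, 0]`. -/
def stdBase (A : Matrix (Fin N) (Fin N) ℤ) : Space A → StdSusp A :=
  basePoint (stdData A)

/-- The orbit equations of a continuous orbit equivalence. -/
def OrbitEqFns (A : Matrix (Fin N) (Fin N) ℤ) (B : Matrix (Fin M) (Fin M) ℤ)
    (h : Space A ≃ₜ Space B) (k1 l1 : C(Space A, ℕ)) (k2 l2 : C(Space B, ℕ)) : Prop :=
  (∀ x : Space A, (shift B)^[k1 x] (h (shift A x)) = (shift B)^[l1 x] (h x)) ∧
  (∀ y : Space B, (shift A)^[k2 y] (h.symm (shift B y)) = (shift A)^[l2 y] (h.symm y))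

/-- `(X_A, σ_A)` and `(X_B, σ_B)` are continuously orbit equivalent. -/
def ContOrbitEquiv (A : Matrix (Fin N) (Fin N) ℤ) (B : Matrix (Fin M) (Fin M) ℤ) : Prop :=
  ∃ h : Space A ≃ₜ Space B, ∃ k1 l1 : C(Space A, ℕ), ∃ k2 l2 : C(Space B, ℕ),
    OrbitEqFns A B h k1 l1 k2 l2

/-- One-sided flow equivalence via the homeomorphism `h`. -/
def FlowEquivVia (A : Matrix (Fin N) (Fin N) ℤ) (B : Matrix (Fin M) (Fin M) ℤ)
    (h : Space A ≃ₜ Space B) : Prop :=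
  ∃ T₁ : SuspData A, IsSuspTriplet T₁ ∧ ∃ T₂ : SuspData B, IsSuspTriplet T₂ ∧
  ∃ Φ₁ : Susp T₁ → StdSusp B, Continuous Φ₁ ∧
  ∃ Φ₂ : Susp T₂ → StdSusp A, Continuous Φ₂ ∧
  (∀ (t : ℝ≥0) (p : Susp T₁), Φ₁ (flow T₁ t p) = flow (stdData B) t (Φ₁ p)) ∧
  (∀ x : Space A, Φ₁ (basePoint T₁ x) = stdBase B (h x)) ∧
  (∀ (t : ℝ≥0) (q : Susp T₂), Φ₂ (flow T₂ t q) = flow (stdData A) t (Φ₂ q)) ∧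
  (∀ y : Space B, Φ₂ (basePoint T₂ y) = stdBase A (h.symm y))

/-- `(X_A, σ_A)` and `(X_B, σ_B)` are one-sided flow equivalent. -/
def OneSidedFlowEquiv (A : Matrix (Fin N) (Fin N) ℤ) (B : Matrix (Fin M) (Fin M) ℤ) : Prop :=
  ∃ h : Space A ≃ₜ Space B, FlowEquivVia A B h

/-- `f^m(x) = Σ_{i<m} f(σ_A^i(x))` for integer-valued `f`. -/
def birk (A : Matrix (Fin N) (Fin N) ℤ) (f : Space A → ℤ) (m : ℕ) (x : Space A) : ℤ :=
  ∑ i ∈ Finset.range m, f ((shift A)^[i] x)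

/-- `f^m(x) = Σ_{i<m} f(σ_A^i(x))` for real-valued `f`. -/
def birkR (A : Matrix (Fin N) (Fin N) ℤ) (f : Space A → ℝ) (m : ℕ) (x : Space A) : ℝ :=
  ∑ i ∈ Finset.range m, f ((shift A)^[i] x)

/-- `f^m(x) = Σ_{i<m} f(σ_A^i(x))` for ℕ-valued `f`. -/
def birkN (A : Matrix (Fin N) (Fin N) ℤ) (f : Space A → ℕ) (m : ℕ) (x : Space A) : ℕ :=
  ∑ i ∈ Finset.range m, f ((shift A)^[i] x)

/-- The map `Ψ_h` associated with a continuous orbit equivalence. -/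
def psi (A : Matrix (Fin N) (Fin N) ℤ) (B : Matrix (Fin M) (Fin M) ℤ)
    (h : Space A → Space B) (l1 k1 : Space A → ℕ) (f : Space B → ℤ) :
    Space A → ℤ :=
  fun x => (∑ i ∈ Finset.range (l1 x), f ((shift B)^[i] (h x)))
    - ∑ j ∈ Finset.range (k1 x), f ((shift B)^[j] (h (shift A x)))

/-- The dynamical zeta function `ζ_{A,f}(s)` with potential `f`. -/
noncomputable def zeta (A : Matrix (Fin N) (Fin N) ℤ) (f : Space A → ℤ) (s : ℂ) : ℂ :=
  Complex.exp (∑' n : ℕ, (1 / (n + 1 : ℂ)) *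
    ∑' x : {x : Space A // (shift A)^[n + 1] x = x},
      Complex.exp (-s * ((birk A f (n + 1) x.1 : ℤ) : ℂ)))

/-- `γ` is a periodic orbit of `(X_A, σ_A)`. -/
def IsPerOrbit (A : Matrix (Fin N) (Fin N) ℤ) (γ : Set (Space A)) : Prop :=
  ∃ (x : Space A) (p : ℕ), 0 < p ∧ (shift A)^[p] x = x ∧
    (∀ q : ℕ, 0 < q → (shift A)^[q] x = x → p ≤ q) ∧
    γ = {y | ∃ i : ℕ, i < p ∧ y = (shift A)^[i] x}

/-- `τ` is a primitive periodic orbit of the flow on the one-sided suspension. -/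
def IsFlowOrbit {A : Matrix (Fin N) (Fin N) ℤ} (T : SuspData A) (τ : Set (Susp T)) : Prop :=
  ∃ u : Susp T, (∃ t : ℝ≥0, 0 < t ∧ flow T t u = u) ∧
    τ = Set.range (fun t : ℝ≥0 => flow T t u)

/-- `ℓ(u) = min { t > 0 : φ_{A,t}(u) = u }`. -/
noncomputable def pointLen {A : Matrix (Fin N) (Fin N) ℤ} (T : SuspData A) (u : Susp T) : ℝ≥0 :=
  sInf {t : ℝ≥0 | 0 < t ∧ flow T t u = u}

/-- `ℓ(τ) = min { t > 0 : φ_{A,t}(u) = u for all u ∈ τ }`. -/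
noncomputable def orbitLen {A : Matrix (Fin N) (Fin N) ℤ} (T : SuspData A)
    (τ : Set (Susp T)) : ℝ≥0 :=
  sInf {t : ℝ≥0 | 0 < t ∧ ∀ u ∈ τ, flow T t u = u}

/-- Every element of the coboundary subgroup is of the form `g - g ∘ σ_A`. -/
lemma exists_eq_sub_comp_of_mem_cobdySubgroup {A : Matrix (Fin N) (Fin N) ℤ}
    {f : C(Space A, ℤ)} (hf : f ∈ cobdySubgroup A) :
    ∃ g : C(Space A, ℤ), f = g - g.comp (shiftMap A) := by
  induction hf using AddSubgroup.closure_induction with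
  | mem f hf => exact hf
  | zero => exact ⟨0, by ext x; simp⟩
  | add f₁ f₂ _ _ h₁ h₂ =>
    obtain ⟨g₁, rfl⟩ := h₁
    obtain ⟨g₂, rfl⟩ := h₂
    refine ⟨g₁ + g₂, ?_⟩
    ext x
    simp only [ContinuousMap.add_apply, ContinuousMap.sub_apply, ContinuousMap.comp_apply]
    ring
  | neg f _ h =>
    obtain ⟨g, rfl⟩ := h
    refine ⟨-g, ?_⟩
    ext x
    simp only [ContinuousMap.neg_apply, ContinuousMap.sub_apply, ContinuousMap.comp_apply]
    ring

lemma isClosed_space (A : Matrix (Fin N) (Fin N) ℤ) :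
    IsClosed {x : ℕ → Fin N | ∀ n, A (x n) (x (n + 1)) = 1} := by
  rw [Set.ofPred_forall]
  refine isClosed_iInter fun n => ?_
  have hA : Continuous fun p : Fin N × Fin N => A p.1 p.2 := continuous_of_discreteTopology
  have hcont : Continuous fun x : ℕ → Fin N => A (x n) (x (n + 1)) :=
    hA.comp (f := fun x : ℕ → Fin N => (x n, x (n + 1)))
      ((continuous_apply n).prodMk (continuous_apply (n + 1)))
  exact isClosed_eq hcont continuous_const

instance compactSpace_space (A : Matrix (Fin N) (Fin N) ℤ) : CompactSpace (Space A) :=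
  isCompact_iff_compactSpace.mp (isClosed_space A).isCompact

/-- Cohomologous functions differ by `g - g ∘ σ_A` with `g` nonnegative. -/
lemma exists_nonneg_of_cohClass_eq {A : Matrix (Fin N) (Fin N) ℤ} {c c' : C(Space A, ℤ)}
    (h : cohClass A c = cohClass A c') :
    ∃ g : C(Space A, ℤ), (∀ x, 0 ≤ g x) ∧ ∀ x, c' x = c x + g x - g (shift A x) := by
  obtain ⟨g, hg⟩ := exists_eq_sub_comp_of_mem_cobdySubgroup (QuotientAddGroup.eq.mp h)
  obtain ⟨m, hm⟩ := (isCompact_range g.continuous).bddBelow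
  refine ⟨g - ContinuousMap.const _ m, fun x => ?_, fun x => ?_⟩
  · simpa using hm (Set.mem_range_self x)
  · have hx : -c x + c' x = g x - g (shift A x) := DFunLike.congr_fun hg x
    simp only [ContinuousMap.sub_apply, ContinuousMap.const_apply]
    linarith

/-- An integer-valued continuous function viewed as a real-valued one. -/
def realOfInt {A : Matrix (Fin N) (Fin N) ℤ} (g : C(Space A, ℤ)) : C(Space A, ℝ) :=
  ⟨fun x => (g x : ℝ), continuous_of_discreteTopology.comp g.continuous⟩

@[simp]
lemma realOfInt_apply {A : Matrix (Fin N) (Fin N) ℤ} (g : C(Space A, ℤ)) (x : Space A) :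
    realOfInt g x = (g x : ℝ) := rfl

/-- The suspension data `(l + u, k + u ∘ σ_A, b + u)`. -/
def SuspData.translate {A : Matrix (Fin N) (Fin N) ℤ} (T : SuspData A) (u : C(Space A, ℝ)) :
    SuspData A :=
  ⟨T.l + u, T.k + u.comp (shiftMap A), T.b + u⟩

section Translate

variable {A : Matrix (Fin N) (Fin N) ℤ} (T : SuspData A) (u : C(Space A, ℝ))

lemma translate_l (x : Space A) : (T.translate u).l x = T.l x + u x := rfl

lemma translate_k (x : Space A) : (T.translate u).k x = T.k x + u (shift A x) := rfl

lemma translate_b (x : Space A) : (T.translate u).b x = T.b x + u x := rfl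

lemma cFun_translate (x : Space A) :
    cFun (T.translate u) x = cFun T x + u x - u (shift A x) := by
  simp only [cFun, translate_l, translate_k]
  ring

/-- The fibrewise translation `(x, r) ↦ (x, r + u(x))` of base spaces. -/
def baseTranslate : BaseSpace T ≃ₜ BaseSpace (T.translate u) where
  toFun p := ⟨(p.1.1, p.1.2 + u p.1.1), by
    simpa only [translate_b] using add_le_add_left p.2 (u p.1.1)⟩
  invFun q := ⟨(q.1.1, q.1.2 - u q.1.1), by
    have h := q.2
    rw [translate_b] at h
    exact le_sub_iff_add_le.mpr h⟩
  left_inv p := Subtype.ext (Prod.ext rfl (add_sub_cancel_right _ _))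
  right_inv q := Subtype.ext (Prod.ext rfl (sub_add_cancel _ _))
  continuous_toFun := by fun_prop
  continuous_invFun := by fun_prop

lemma suspRel_baseTranslate_iff (p q : BaseSpace T) :
    SuspRel (T.translate u) (baseTranslate T u p) (baseTranslate T u q) ↔ SuspRel T p q := by
  simp only [SuspRel, baseTranslate, Homeomorph.homeomorph_mk_coe, Equiv.coe_fn_mk,
    translate_l, cFun_translate, add_le_add_iff_right, Prod.ext_iff]
  refine and_congr_right fun _ => and_congr_right fun h => ?_
  rw [h]
  constructor <;> intro h' <;> linarith

lemma eqvGen_of_map {α β : Type*} {r : α → α → Prop} {s : β → β → Prop} (f : α → β)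
    (hf : ∀ a b, r a b → s (f a) (f b)) {a b : α} (h : Relation.EqvGen r a b) :
    Relation.EqvGen s (f a) (f b) := by
  induction h with
  | rel a b hab => exact .rel _ _ (hf a b hab)
  | refl a => exact .refl _
  | symm a b _ ih => exact .symm _ _ ih
  | trans a b c _ _ ih₁ ih₂ => exact .trans _ _ _ ih₁ ih₂

lemma suspSetoid_baseTranslate_iff (p q : BaseSpace T) :
    suspSetoid T p q ↔
      suspSetoid (T.translate u) (baseTranslate T u p) (baseTranslate T u q) := by
  refine ⟨eqvGen_of_map _ fun a b => (suspRel_baseTranslate_iff T u a b).mpr, fun h => ?_⟩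
  have key := eqvGen_of_map (s := SuspRel T) (baseTranslate T u).symm (fun a b hab => by
    rw [← suspRel_baseTranslate_iff T u]
    simpa only [Homeomorph.apply_symm_apply] using hab) h
  simp only [Homeomorph.symm_apply_apply] at key
  exact key

/-- The homeomorphism `[x, r] ↦ [x, r + u(x)]` of one-sided suspensions. -/
def suspTranslate : Susp T ≃ₜ Susp (T.translate u) where
  toEquiv := Quotient.congr (baseTranslate T u).toEquiv (suspSetoid_baseTranslate_iff T u)
  continuous_toFun := (baseTranslate T u).continuous.quotient_map'
    fun p q => (suspSetoid_baseTranslate_iff T u p q).mp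
  continuous_invFun := (baseTranslate T u).symm.continuous.quotient_map' fun p q h => by
    rw [suspSetoid_baseTranslate_iff T u]
    simpa only [Homeomorph.apply_symm_apply] using h

lemma suspTranslate_flow (t : ℝ≥0) (p : Susp T) :
    suspTranslate T u (flow T t p) = flow (T.translate u) t (suspTranslate T u p) := by
  induction p using Quotient.inductionOn with
  | h p =>
    change mkSusp _ (baseTranslate T u (shiftPt T t p)) =
      mkSusp _ (shiftPt (T.translate u) t (baseTranslate T u p))
    exact congrArg _ (Subtype.ext (Prod.ext rfl (add_right_comm _ _ _)))

end Translate

theorem susp_of_cohomologous_potential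
    {N : ℕ} (A : Matrix (Fin N) (Fin N) ℤ)
    (hN : 1 < N) (hA01 : IsZeroOne A)
    (hAirr : IsIrreducible A) (hAnp : ¬ IsPermutationMatrix A)
    (T : SuspData A) (hT : IsSuspTriplet T)
    (c c' : C(Space A, ℤ)) (hc : ∀ x, (c x : ℝ) = cFun T x)
    (hcc' : cohClass A c = cohClass A c') :
    ∃ T' : SuspData A, IsSuspTriplet T' ∧ (∀ x, (c' x : ℝ) = cFun T' x) ∧
      ∃ Φ : Susp T ≃ₜ Susp T',
        (∀ x : Space A, Φ (basePoint T x) = basePoint T' x) ∧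
        (∀ (t : ℝ≥0) (p : Susp T), Φ (flow T t p) = flow T' t (Φ p)) := by
  obtain ⟨g, hg0, hg⟩ := exists_nonneg_of_cohClass_eq hcc'
  obtain ⟨hl, hk, ⟨c₀, hc₀, hunit⟩, hlb, hkb⟩ := hT
  obtain rfl : c₀ = c := by
    ext x
    exact_mod_cast (hc₀ x).trans (hc x).symm
  have hg0' (x : Space A) : (0 : ℝ) ≤ g x := by exact_mod_cast hg0 x
  have hc' (x : Space A) : (c' x : ℝ) = cFun (T.translate (realOfInt g)) x := by
    simp only [cFun_translate, realOfInt_apply, ← hc, hg]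
    push_cast
    rfl
  refine ⟨T.translate (realOfInt g), ⟨fun x => ?_, fun x => ?_, ⟨c', hc', hcc' ▸ hunit⟩,
    fun x => ?_, fun x => ?_⟩, hc', suspTranslate T _, fun x => rfl, suspTranslate_flow T _⟩
  · exact add_nonneg (hl x) (hg0' x)
  · exact add_nonneg (hk x) (hg0' (shift A x))
  · simpa only [translate_l, translate_b, add_sub_add_right_eq_sub] using hlb x
  · simpa only [translate_k, translate_b, add_sub_add_right_eq_sub] using hkb x

end OneSidedMarkov
end

section
/- Let (S_{A,b}^{l,k}, φ_A) be a one-sided suspension of (X_A, σ_A) with c = l − k. Then there exists a bijective correspondence τ ↦ γ_τ between the primitive periodic orbits τ of the flow φ_A on S_{A,b}^{l,k} and the periodic orbits γ of (X_A, σ_A), such that ℓ(τ) = Σ_{i=0}^{p−1} c(σ_A^i(x)) whenever γ_τ = {x, σ_A(x), …, σ_A^{p−1}(x)} is the orbit of a periodic point x of least period p; here ℓ(τ) = min{t > 0 : φ_{A,t}(u) = u} for any point u ∈ τ. -/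
open scoped BigOperators NNReal

namespace OneSidedMarkov

variable {N M : ℕ}

section Cohomology

variable {A : Matrix (Fin N) (Fin N) ℤ}

/-- The Birkhoff sum `f^d(x)` as a homomorphism in `f`. -/
def birkHom (d : ℕ) (x : Space A) : C(Space A, ℤ) →+ ℤ where
  toFun f := birk A f d x
  map_zero' := by simp [birk]
  map_add' f g := by simp [birk, Finset.sum_add_distrib]

lemma birkHom_eq_zero_of_mem_cobdySubgroup {d : ℕ} {x : Space A} (hx : (shift A)^[d] x = x)
    {f : C(Space A, ℤ)} (hf : f ∈ cobdySubgroup A) : birkHom d x f = 0 := by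
  have hle : cobdySubgroup A ≤ (birkHom d x).ker := by
    refine (AddSubgroup.closure_le _).2 ?_
    rintro _ ⟨g, rfl⟩
    change ∑ i ∈ Finset.range d, (g ((shift A)^[i] x) - g (shift A ((shift A)^[i] x))) = 0
    simp only [← Function.iterate_succ_apply']
    rw [Finset.sum_range_sub' (fun i => g ((shift A)^[i] x)) d]
    simp [hx]
  exact hle hf

lemma birk_pos_of_isOrderUnit {c : C(Space A, ℤ)} (hc : IsOrderUnit A (cohClass A c))
    {d : ℕ} (hd : 0 < d) {x : Space A} (hx : (shift A)^[d] x = x) : 0 < birk A c d x := by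
  obtain ⟨n, -, f, hf, hnf⟩ := hc.2 (cohClass A 1)
  have hmem : -(n • c - 1) + f ∈ cobdySubgroup A := QuotientAddGroup.eq.1 hnf
  have hzero := birkHom_eq_zero_of_mem_cobdySubgroup hx hmem
  rw [map_add, map_neg, map_sub, map_nsmul] at hzero
  have hone : birkHom d x (1 : C(Space A, ℤ)) = d := by
    simp [birkHom, birk]
  have hfpos : 0 ≤ birkHom d x f := by
    change 0 ≤ ∑ i ∈ Finset.range d, f ((shift A)^[i] x)
    exact Finset.sum_nonneg fun i _ => hf _
  rw [hone, nsmul_eq_mul] at hzero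
  have hpos : 0 < (n : ℤ) * birkHom d x c := by
    have : (0 : ℤ) < d := by exact_mod_cast hd
    linarith
  exact pos_of_mul_pos_right hpos (Int.natCast_nonneg n)

lemma birkR_add (f : Space A → ℝ) (m n : ℕ) (x : Space A) :
    birkR A f (m + n) x = birkR A f m x + birkR A f n ((shift A)^[m] x) := by
  simp only [birkR, Finset.sum_range_add, ← Function.iterate_add_apply, Nat.add_comm]

lemma birkR_cFun_pos {T : SuspData A} (hT : IsSuspTriplet T) {d : ℕ} (hd : 0 < d)
    {x : Space A} (hx : (shift A)^[d] x = x) : 0 < birkR A (cFun T) d x := by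
  obtain ⟨c, hc, hunit⟩ := hT.2.2.1
  have hcast : birkR A (cFun T) d x = (birk A c d x : ℤ) := by
    simp [birkR, birk, ← hc]
  rw [hcast]
  exact_mod_cast birk_pos_of_isOrderUnit hunit hd hx

lemma birkR_cFun_nonneg {T : SuspData A} (hT : IsSuspTriplet T) {d : ℕ}
    {x : Space A} (hx : (shift A)^[d] x = x) : 0 ≤ birkR A (cFun T) d x := by
  rcases Nat.eq_zero_or_pos d with rfl | hd
  · simp [birkR]
  · exact (birkR_cFun_pos hT hd hx).le

end Cohomology

section PeriodicOrbits

variable {A : Matrix (Fin N) (Fin N) ℤ}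

/-- The forward orbit of `x` under the shift. -/
def shiftOrbit (x : Space A) : Set (Space A) := Set.range fun i : ℕ => (shift A)^[i] x

lemma orbit_below_period_eq {x : Space A} {p : ℕ} (hp : 0 < p) (hx : (shift A)^[p] x = x) :
    {y | ∃ i : ℕ, i < p ∧ y = (shift A)^[i] x} = shiftOrbit x := by
  ext y
  constructor
  · rintro ⟨i, -, rfl⟩
    exact ⟨i, rfl⟩
  · rintro ⟨i, rfl⟩
    exact ⟨i % p, Nat.mod_lt _ hp, (Function.IsPeriodicPt.iterate_mod_apply hx i).symm⟩

lemma shiftOrbit_iterate {x : Space A} {p : ℕ} (hp : 0 < p) (hx : (shift A)^[p] x = x) (n : ℕ) :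
    shiftOrbit ((shift A)^[n] x) = shiftOrbit x := by
  ext y
  constructor
  · rintro ⟨i, rfl⟩
    exact ⟨i + n, Function.iterate_add_apply _ _ _ _⟩
  · rintro ⟨i, rfl⟩
    refine ⟨i + (n * p - n), ?_⟩
    have hn : n ≤ n * p := Nat.le_mul_of_pos_right n hp
    have hper : (shift A)^[n * p] x = x := Function.IsPeriodicPt.const_mul hx n
    change (shift A)^[i + (n * p - n)] ((shift A)^[n] x) = (shift A)^[i] x
    rw [← Function.iterate_add_apply, show i + (n * p - n) + n = i + n * p by omega,
      Function.iterate_add_apply, hper]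

lemma isPerOrbit_iff {γ : Set (Space A)} :
    IsPerOrbit A γ ↔ ∃ (x : Space A) (p : ℕ), 0 < p ∧ (shift A)^[p] x = x ∧ γ = shiftOrbit x := by
  constructor
  · rintro ⟨x, p, hp, hx, -, rfl⟩
    exact ⟨x, p, hp, hx, orbit_below_period_eq hp hx⟩
  · rintro ⟨x, p, hp, hx, rfl⟩
    have hmp : 0 < Function.minimalPeriod (shift A) x :=
      Function.IsPeriodicPt.minimalPeriod_pos hp hx
    have hmx := Function.iterate_minimalPeriod (f := shift A) (x := x)
    exact ⟨x, _, hmp, hmx, fun q hq hqx => Function.IsPeriodicPt.minimalPeriod_le hq hqx,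
      (orbit_below_period_eq hmp hmx).symm⟩

lemma IsPerOrbit.exists_period {γ : Set (Space A)} (hγ : IsPerOrbit A γ) {x : Space A}
    (hx : x ∈ γ) : ∃ p, 0 < p ∧ (shift A)^[p] x = x ∧ γ = shiftOrbit x := by
  obtain ⟨y, p, hp, hy, rfl⟩ := isPerOrbit_iff.1 hγ
  obtain ⟨i, rfl⟩ := hx
  exact ⟨p, hp, Function.IsPeriodicPt.apply_iterate hy i, (shiftOrbit_iterate hp hy i).symm⟩

lemma IsPerOrbit.eq_of_iterate_eq {γ γ' : Set (Space A)} (hγ : IsPerOrbit A γ)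
    (hγ' : IsPerOrbit A γ') {x x' : Space A} (hx : x ∈ γ) (hx' : x' ∈ γ') {m n : ℕ}
    (h : (shift A)^[m] x = (shift A)^[n] x') : γ = γ' := by
  obtain ⟨p, hp, hpx, rfl⟩ := hγ.exists_period hx
  obtain ⟨q, hq, hqx, rfl⟩ := hγ'.exists_period hx'
  rw [← shiftOrbit_iterate hp hpx m, ← shiftOrbit_iterate hq hqx n, h]

end PeriodicOrbits

section Suspension

variable {A : Matrix (Fin N) (Fin N) ℤ} {T : SuspData A}

lemma exists_iterate_of_reflTransGen {p q : BaseSpace T}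
    (h : Relation.ReflTransGen (SuspRel T) p q) :
    ∃ n, q.1.1 = (shift A)^[n] p.1.1 ∧ q.1.2 = p.1.2 - birkR A (cFun T) n p.1.1 := by
  induction h with
  | refl => exact ⟨0, rfl, by simp [birkR]⟩
  | tail _ hqr ih =>
    obtain ⟨n, h1, h2⟩ := ih
    refine ⟨n + 1, ?_, ?_⟩
    · rw [hqr.2, Function.iterate_succ_apply', h1]
    · rw [hqr.2, birkR_add]
      simp [birkR, h1, h2]
      ring

lemma exists_join_of_mkSusp_eq {p q : BaseSpace T} (h : mkSusp T p = mkSusp T q) :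
    Relation.Join (Relation.ReflTransGen (SuspRel T)) p q := by
  have hequiv : Equivalence (Relation.Join (Relation.ReflTransGen (SuspRel T))) := by
    refine Relation.equivalence_join_reflTransGen fun a b c hab hac => ?_
    have hbc : b = c := Subtype.ext (hab.2.trans hac.2.symm)
    exact ⟨b, .refl, hbc ▸ .refl⟩
  have hgen : Relation.EqvGen (SuspRel T) p q := Quotient.exact h
  induction hgen with
  | rel a b hab => exact ⟨b, .single hab, .refl⟩
  | refl a => exact hequiv.refl a
  | symm a b hab ih => exact hequiv.symm (ih (Quotient.sound hab))
  | trans a b c hab hbc ih₁ ih₂ =>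
    exact hequiv.trans (ih₁ (Quotient.sound hab)) (ih₂ (Quotient.sound hbc))

lemma mkSusp_eq_of_reflTransGen {p q : BaseSpace T}
    (h : Relation.ReflTransGen (SuspRel T) p q) : mkSusp T p = mkSusp T q := by
  induction h with
  | refl => rfl
  | tail _ hqr ih => exact ih.trans (Quotient.sound (Relation.EqvGen.rel _ _ hqr))

lemma exists_iterate_eq_of_mkSusp_eq {p q : BaseSpace T} (h : mkSusp T p = mkSusp T q) :
    ∃ m n, (shift A)^[m] p.1.1 = (shift A)^[n] q.1.1 ∧
      p.1.2 - birkR A (cFun T) m p.1.1 = q.1.2 - birkR A (cFun T) n q.1.1 := by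
  obtain ⟨w, hpw, hqw⟩ := exists_join_of_mkSusp_eq h
  obtain ⟨m, h1, h2⟩ := exists_iterate_of_reflTransGen hpw
  obtain ⟨n, h3, h4⟩ := exists_iterate_of_reflTransGen hqw
  exact ⟨m, n, h1.symm.trans h3, h2.symm.trans h4⟩

/-- High enough above `x`, the class `[x, r]` equals `[σ^n x, r - c^n(x)]`. -/
lemma exists_height_mkSusp_iterate (hT : IsSuspTriplet T) (x : Space A) (n : ℕ) :
    ∃ R, ∀ r, R ≤ r → ∀ h : T.b x ≤ r,
      ∃ h' : T.b ((shift A)^[n] x) ≤ r - birkR A (cFun T) n x,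
        mkSusp T ⟨(x, r), h⟩ = mkSusp T ⟨((shift A)^[n] x, r - birkR A (cFun T) n x), h'⟩ := by
  induction n with
  | zero => exact ⟨0, fun r _ h => ⟨by simpa [birkR] using h, by simp [birkR]⟩⟩
  | succ n ih =>
    obtain ⟨R, hR⟩ := ih
    refine ⟨max R (T.l ((shift A)^[n] x) + birkR A (cFun T) n x), fun r hr h => ?_⟩
    obtain ⟨h', heq⟩ := hR r ((le_max_left _ _).trans hr) h
    have hl := (le_max_right _ _).trans hr
    have hsum : birkR A (cFun T) (n + 1) x
        = birkR A (cFun T) n x + cFun T ((shift A)^[n] x) := by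
      simp [birkR, Finset.sum_range_succ]
    obtain ⟨m, hm⟩ := hT.2.2.2.2 ((shift A)^[n] x)
    have hm0 : (0 : ℝ) ≤ m := m.cast_nonneg
    refine ⟨?_, heq.trans (Quotient.sound (Relation.EqvGen.rel _ _ ⟨?_, ?_⟩))⟩
    · rw [Function.iterate_succ_apply', hsum]
      simp only [cFun]
      linarith
    · change T.l ((shift A)^[n] x) ≤ r - birkR A (cFun T) n x
      linarith
    · change ((shift A)^[n + 1] x, r - birkR A (cFun T) (n + 1) x) = _
      rw [Function.iterate_succ_apply', hsum, sub_add_eq_sub_sub]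

lemma exists_eq_mkSusp (u : Susp T) :
    ∃ (x : Space A) (r : ℝ) (h : T.b x ≤ r), u = mkSusp T ⟨(x, r), h⟩ := by
  induction u using Quotient.inductionOn with
  | h p => exact ⟨p.1.1, p.1.2, p.2, rfl⟩

lemma flow_mkSusp (t : ℝ≥0) (p : BaseSpace T) :
    flow T t (mkSusp T p) = mkSusp T (shiftPt T t p) := rfl

lemma flow_flow (s t : ℝ≥0) (u : Susp T) : flow T s (flow T t u) = flow T (t + s) u := by
  obtain ⟨x, r, h, rfl⟩ := exists_eq_mkSusp u
  simp only [flow_mkSusp, shiftPt, NNReal.coe_add, add_assoc]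

lemma flow_nsmul {t : ℝ≥0} {u : Susp T} (h : flow T t u = u) (n : ℕ) : flow T (n • t) u = u := by
  induction n with
  | zero =>
    obtain ⟨x, r, h, rfl⟩ := exists_eq_mkSusp u
    simp [flow_mkSusp, shiftPt]
  | succ n ih => rw [succ_nsmul, ← flow_flow, ih, h]

/-- The point `u` is periodic under the flow. -/
def IsFlowPeriodic (T : SuspData A) (u : Susp T) : Prop := ∃ t : ℝ≥0, 0 < t ∧ flow T t u = u

lemma IsFlowPeriodic.flow {u : Susp T} (hu : IsFlowPeriodic T u) (s : ℝ≥0) :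
    IsFlowPeriodic T (flow T s u) := by
  obtain ⟨t, ht, h⟩ := hu
  exact ⟨t, ht, by rw [flow_flow, add_comm, ← flow_flow, h]⟩

/-- A periodic class has representatives at arbitrarily large heights. -/
lemma exists_height_of_isFlowPeriodic {x : Space A} {r : ℝ} {h : T.b x ≤ r}
    (hu : IsFlowPeriodic T (mkSusp T ⟨(x, r), h⟩)) (R : ℝ) :
    ∃ (r' : ℝ) (h' : T.b x ≤ r'), R ≤ r' ∧
      mkSusp T ⟨(x, r), h⟩ = mkSusp T ⟨(x, r'), h'⟩ := by
  obtain ⟨t, ht, hfix⟩ := hu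
  obtain ⟨n, hn⟩ := Archimedean.arch (R - r) (show (0 : ℝ) < t from ht)
  refine ⟨_, (shiftPt T (n • t) ⟨(x, r), h⟩).2, ?_, (flow_nsmul hfix n).symm⟩
  have hcast : ((n • t : ℝ≥0) : ℝ) = n • (t : ℝ) := NNReal.coe_nsmul _ _
  simp only [shiftPt]
  linarith

/-- A periodic class can be transported along the base to any forward iterate, at arbitrarily
large height. -/
lemma exists_mkSusp_iterate_of_isFlowPeriodic (hT : IsSuspTriplet T) {x : Space A} {r : ℝ}
    {h : T.b x ≤ r} (hu : IsFlowPeriodic T (mkSusp T ⟨(x, r), h⟩)) (n : ℕ) (R : ℝ) :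
    ∃ (r' : ℝ) (h' : T.b ((shift A)^[n] x) ≤ r'), R ≤ r' ∧
      mkSusp T ⟨(x, r), h⟩ = mkSusp T ⟨((shift A)^[n] x, r'), h'⟩ := by
  obtain ⟨S, hS⟩ := exists_height_mkSusp_iterate hT x n
  obtain ⟨r₁, h₁, hr₁, heq⟩ :=
    exists_height_of_isFlowPeriodic hu (max S (R + birkR A (cFun T) n x))
  obtain ⟨h', heq'⟩ := hS r₁ ((le_max_left _ _).trans hr₁) h₁
  exact ⟨_, h', by linarith [(le_max_right _ _).trans hr₁], heq.trans heq'⟩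

/-- High enough above a `p`-periodic point, the flow returns after time `c^p(x)`. -/
lemma exists_height_flow_eq (hT : IsSuspTriplet T) {x : Space A} {p : ℕ}
    (hx : (shift A)^[p] x = x) :
    ∃ R, ∀ r, R ≤ r → ∀ h : T.b x ≤ r, ∀ t : ℝ≥0, (t : ℝ) = birkR A (cFun T) p x →
      flow T t (mkSusp T ⟨(x, r), h⟩) = mkSusp T ⟨(x, r), h⟩ := by
  obtain ⟨R, hR⟩ := exists_height_mkSusp_iterate hT x p
  refine ⟨R, fun r hr h t ht => ?_⟩
  obtain ⟨h', heq⟩ := hR (r + t) (hr.trans (le_add_of_nonneg_right t.2))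
    (h.trans (le_add_of_nonneg_right t.2))
  refine heq.trans (congrArg (mkSusp T) (Subtype.ext (Prod.ext hx ?_)))
  change r + t - birkR A (cFun T) p x = r
  rw [← ht, add_sub_cancel_right]

/-- Every return time is a Birkhoff sum over a period of a forward iterate. -/
lemma exists_period_of_flow_eq (hT : IsSuspTriplet T) {p : BaseSpace T} {t : ℝ≥0} (ht : 0 < t)
    (h : flow T t (mkSusp T p) = mkSusp T p) :
    ∃ m d, 0 < d ∧ (shift A)^[d] ((shift A)^[m] p.1.1) = (shift A)^[m] p.1.1 ∧
      (t : ℝ) = birkR A (cFun T) d ((shift A)^[m] p.1.1) ∧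
      ∃ q : BaseSpace T, q.1.1 = (shift A)^[m] p.1.1 ∧ mkSusp T p = mkSusp T q := by
  obtain ⟨w, h1, h2⟩ := exists_join_of_mkSusp_eq (flow_mkSusp t p ▸ h)
  obtain ⟨n, hn, hn'⟩ := exists_iterate_of_reflTransGen h1
  obtain ⟨m, hm, hm'⟩ := exists_iterate_of_reflTransGen h2
  simp only [shiftPt] at hn hn'
  have ht' : (0 : ℝ) < t := ht
  have hnm : m < n := by
    by_contra hle
    obtain ⟨d, rfl⟩ := Nat.exists_eq_add_of_le (not_lt.1 hle)
    have hd : (shift A)^[d] ((shift A)^[n] p.1.1) = (shift A)^[n] p.1.1 := by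
      rw [← Function.iterate_add_apply, Nat.add_comm d n, ← hm, hn]
    have hnonneg := birkR_cFun_nonneg hT hd
    rw [birkR_add] at hm'
    linarith
  obtain ⟨d, rfl⟩ := Nat.exists_eq_add_of_lt hnm
  rw [add_assoc] at hn hn'
  refine ⟨m, d + 1, d.succ_pos, ?_, ?_, w, hm, mkSusp_eq_of_reflTransGen h2⟩
  · rw [← Function.iterate_add_apply, Nat.add_comm (d + 1) m, ← hn, hm]
  · rw [birkR_add] at hn'
    linarith

/-- The periodic points of the flow lying over `γ`. -/
def flowOrbitOver (T : SuspData A) (γ : Set (Space A)) : Set (Susp T) :=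
  {u | IsFlowPeriodic T u ∧ ∃ x ∈ γ, ∃ (r : ℝ) (h : T.b x ≤ r), u = mkSusp T ⟨(x, r), h⟩}

lemma exists_height_of_mem_flowOrbitOver (hT : IsSuspTriplet T) {γ : Set (Space A)}
    (hγ : IsPerOrbit A γ) {u : Susp T} (hu : u ∈ flowOrbitOver T γ) {x : Space A} (hx : x ∈ γ)
    (R : ℝ) : ∃ (r : ℝ) (h : T.b x ≤ r), R ≤ r ∧ u = mkSusp T ⟨(x, r), h⟩ := by
  obtain ⟨hper, z, hz, r, h, rfl⟩ := hu
  obtain ⟨p, hp, hpz, rfl⟩ := hγ.exists_period hz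
  obtain ⟨i, rfl⟩ := hx
  exact exists_mkSusp_iterate_of_isFlowPeriodic hT hper i R

lemma flowOrbitOver_eq_range (hT : IsSuspTriplet T) {γ : Set (Space A)} (hγ : IsPerOrbit A γ)
    {u : Susp T} (hu : u ∈ flowOrbitOver T γ) :
    flowOrbitOver T γ = Set.range fun t : ℝ≥0 => flow T t u := by
  obtain ⟨hper, x, hx, r, h, rfl⟩ := hu
  ext v
  constructor
  · intro hv
    obtain ⟨r', h', hr', rfl⟩ := exists_height_of_mem_flowOrbitOver hT hγ hv hx r
    refine ⟨⟨r' - r, sub_nonneg.2 hr'⟩, congrArg (mkSusp T) (Subtype.ext (Prod.ext rfl ?_))⟩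
    change r + (r' - r) = r'
    ring
  · rintro ⟨t, rfl⟩
    exact ⟨hper.flow t, x, hx, _, (shiftPt T t ⟨(x, r), h⟩).2, rfl⟩

lemma flowOrbitOver_nonempty (hT : IsSuspTriplet T) {γ : Set (Space A)} (hγ : IsPerOrbit A γ) :
    (flowOrbitOver T γ).Nonempty := by
  obtain ⟨x, p, hp, hx, rfl⟩ := isPerOrbit_iff.1 hγ
  have hpos := birkR_cFun_pos hT hp hx
  obtain ⟨R, hR⟩ := exists_height_flow_eq hT hx
  exact ⟨mkSusp T ⟨(x, max R (T.b x)), le_max_right _ _⟩,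
    ⟨⟨_, hpos.le⟩, hpos, hR _ (le_max_left _ _) _ _ rfl⟩, x, ⟨0, rfl⟩, _, _, rfl⟩

lemma isFlowOrbit_flowOrbitOver (hT : IsSuspTriplet T) {γ : Set (Space A)}
    (hγ : IsPerOrbit A γ) : IsFlowOrbit T (flowOrbitOver T γ) := by
  obtain ⟨u, hu⟩ := flowOrbitOver_nonempty hT hγ
  exact ⟨u, hu.1, flowOrbitOver_eq_range hT hγ hu⟩

lemma flowOrbitOver_bijective (hT : IsSuspTriplet T) :
    Function.Bijective fun γ : {γ : Set (Space A) // IsPerOrbit A γ} =>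
      (⟨flowOrbitOver T γ.1, isFlowOrbit_flowOrbitOver hT γ.2⟩ :
        {τ : Set (Susp T) // IsFlowOrbit T τ}) := by
  constructor
  · rintro ⟨γ, hγ⟩ ⟨γ', hγ'⟩ heq
    have hsets : flowOrbitOver T γ = flowOrbitOver T γ' := congrArg Subtype.val heq
    obtain ⟨u, hu⟩ := flowOrbitOver_nonempty hT hγ
    obtain ⟨-, x, hx, r, h, hux⟩ := id hu
    obtain ⟨-, x', hx', r', h', hux'⟩ := hsets ▸ hu
    obtain ⟨m, n, hmn, -⟩ := exists_iterate_eq_of_mkSusp_eq (hux.symm.trans hux')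
    exact Subtype.ext (hγ.eq_of_iterate_eq hγ' hx hx' hmn)
  · rintro ⟨τ, u, hu, rfl⟩
    obtain ⟨t, ht, hfix⟩ := id hu
    obtain ⟨x, r, h, rfl⟩ := exists_eq_mkSusp u
    obtain ⟨m, d, hd, hper, -, q, hq, hmk⟩ := exists_period_of_flow_eq hT ht hfix
    have hγ : IsPerOrbit A (shiftOrbit q.1.1) :=
      isPerOrbit_iff.2 ⟨q.1.1, d, hd, by rw [hq]; exact hper, rfl⟩
    exact ⟨⟨_, hγ⟩, Subtype.ext (flowOrbitOver_eq_range hT hγ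
      ⟨hu, q.1.1, ⟨0, rfl⟩, q.1.2, q.2, hmk⟩)⟩

/-- If `x` has least period `p`, then `c^p(x)` is at most any positive Birkhoff sum of `c` over a
period of a forward iterate of `x`. -/
lemma birkR_cFun_le_of_period (hT : IsSuspTriplet T) {x : Space A} {p : ℕ} (hp : 0 < p)
    (hx : (shift A)^[p] x = x) (hmin : ∀ q : ℕ, 0 < q → (shift A)^[q] x = x → p ≤ q)
    {m d : ℕ} (hd : 0 < d) (h : (shift A)^[d] ((shift A)^[m] x) = (shift A)^[m] x) :
    birkR A (cFun T) p x ≤ birkR A (cFun T) d ((shift A)^[m] x) := by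
  have hdx : (shift A)^[d] x = x := by
    obtain ⟨j, hj⟩ : x ∈ shiftOrbit ((shift A)^[m] x) := by
      rw [shiftOrbit_iterate hp hx]
      exact ⟨0, rfl⟩
    rw [← hj]
    exact Function.IsPeriodicPt.apply_iterate h j
  have hcomm : birkR A (cFun T) d ((shift A)^[m] x) = birkR A (cFun T) d x := by
    have h1 := birkR_add (cFun T) m d x
    rw [Nat.add_comm, birkR_add, hdx] at h1
    linarith
  obtain ⟨e, rfl⟩ := Nat.exists_eq_add_of_le (hmin d hd hdx)
  have hex : (shift A)^[e] x = x := by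
    rwa [Nat.add_comm, Function.iterate_add_apply, hx] at hdx
  rw [hcomm, birkR_add, hx]
  linarith [birkR_cFun_nonneg hT hex]

lemma pointLen_eq_birkR (hT : IsSuspTriplet T) {γ : Set (Space A)} (hγ : IsPerOrbit A γ)
    {u : Susp T} (hu : u ∈ flowOrbitOver T γ) {x : Space A} (hxγ : x ∈ γ) {p : ℕ} (hp : 0 < p)
    (hx : (shift A)^[p] x = x) (hmin : ∀ q : ℕ, 0 < q → (shift A)^[q] x = x → p ≤ q) :
    (pointLen T u : ℝ) = birkR A (cFun T) p x := by
  have hpos := birkR_cFun_pos hT hp hx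
  obtain ⟨R, hR⟩ := exists_height_flow_eq hT hx
  obtain ⟨r, h, hr, rfl⟩ := exists_height_of_mem_flowOrbitOver hT hγ hu hxγ R
  have hleast : IsLeast {t : ℝ≥0 | 0 < t ∧ flow T t (mkSusp T ⟨(x, r), h⟩)
      = mkSusp T ⟨(x, r), h⟩} ⟨birkR A (cFun T) p x, hpos.le⟩ := by
    refine ⟨⟨hpos, hR r hr h _ rfl⟩, ?_⟩
    rintro t ⟨ht, hfix⟩
    obtain ⟨m, d, hd, hper, hlen, -⟩ := exists_period_of_flow_eq hT ht hfix
    change birkR A (cFun T) p x ≤ t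
    rw [hlen]
    exact birkR_cFun_le_of_period hT hp hx hmin hd hper
  rw [pointLen, hleast.csInf_eq]
  rfl

end Suspension

theorem flow_orbit_correspondence
    {N : ℕ} (A : Matrix (Fin N) (Fin N) ℤ)
    (hN : 1 < N) (hA01 : IsZeroOne A)
    (hAirr : IsIrreducible A) (hAnp : ¬ IsPermutationMatrix A)
    (T : SuspData A) (hT : IsSuspTriplet T) :
    ∃ Ψ : {τ : Set (Susp T) // IsFlowOrbit T τ} ≃ {γ : Set (Space A) // IsPerOrbit A γ},
      ∀ (τ : {τ : Set (Susp T) // IsFlowOrbit T τ}) (u : Susp T) (x : Space A) (p : ℕ),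
        u ∈ τ.1 → 0 < p → (shift A)^[p] x = x →
        (∀ q : ℕ, 0 < q → (shift A)^[q] x = x → p ≤ q) →
        (Ψ τ).1 = {y | ∃ i : ℕ, i < p ∧ y = (shift A)^[i] x} →
        (pointLen T u : ℝ) = birkR A (cFun T) p x := by
  let Φ := Equiv.ofBijective _ (flowOrbitOver_bijective hT)
  refine ⟨Φ.symm, fun τ u x p hu hp hx hmin hΨ => ?_⟩
  obtain ⟨γ, rfl⟩ := Φ.surjective τ
  rw [Equiv.symm_apply_apply] at hΨ
  exact pointLen_eq_birkR hT γ.2 hu (hΨ ▸ ⟨0, hp, rfl⟩) hp hx hmin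

end OneSidedMarkov
end

section
/- Suppose (X_A, σ_A) and (X_B, σ_B) are continuously orbit equivalent via a homeomorphism h : X_A → X_B with functions k_1, l_1 : X_A → ℤ_{≥0} and k_2, l_2 : X_B → ℤ_{≥0}. Then for every m ∈ ℤ_{≥0}, f ∈ C(X_B, ℤ), and g ∈ C(X_A, ℤ): (i) Ψ_h(f)^m(x) = f^{l_1^m(x)}(h(x)) − f^{k_1^m(x)}(h(σ_A^m(x))) for all x ∈ X_A, and consequently g^m(x) = Ψ_{h^{−1}}(g)^{l_1^m(x)}(h(x)) − Ψ_{h^{−1}}(g)^{k_1^m(x)}(h(σ_A^m(x))); (ii) Ψ_{h^{−1}}(g)^m(y) = g^{l_2^m(y)}(h^{−1}(y)) − g^{k_2^m(y)}(h^{−1}(σ_B^m(y))) for all y ∈ X_B, and consequently f^m(y) = Ψ_h(f)^{l_2^m(y)}(h^{−1}(y)) − Ψ_h(f)^{k_2^m(y)}(h^{−1}(σ_B^m(y))). -/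
open scoped BigOperators NNReal

namespace OneSidedMarkov

variable {N M : ℕ}

lemma birk_add (A : Matrix (Fin N) (Fin N) ℤ) (f : Space A → ℤ) (m n : ℕ) (x : Space A) :
    birk A f (m + n) x = birk A f m x + birk A f n ((shift A)^[m] x) := by
  simp only [birk, Finset.sum_range_add, ← Function.iterate_add_apply]
  simp only [add_comm]

lemma birk_one (A : Matrix (Fin N) (Fin N) ℤ) (f : Space A → ℤ) (x : Space A) :
    birk A f 1 x = f x := by
  simp [birk]

lemma birkN_succ (A : Matrix (Fin N) (Fin N) ℤ) (f : Space A → ℕ) (m : ℕ) (x : Space A) :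
    birkN A f (m + 1) x = birkN A f m x + f ((shift A)^[m] x) :=
  Finset.sum_range_succ _ _

lemma psi_eq_birk (A : Matrix (Fin N) (Fin N) ℤ) (B : Matrix (Fin M) (Fin M) ℤ)
    (h : Space A → Space B) (l k : Space A → ℕ) (f : Space B → ℤ) (x : Space A) :
    psi A B h l k f x = birk B f (l x) (h x) - birk B f (k x) (h (shift A x)) :=
  rfl

section Cocycle

variable {A : Matrix (Fin N) (Fin N) ℤ} {B : Matrix (Fin M) (Fin M) ℤ}
  {h : Space A → Space B} {k l : Space A → ℕ}

lemma iterate_birkN_orbit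
    (horb : ∀ x, (shift B)^[k x] (h (shift A x)) = (shift B)^[l x] (h x))
    (m : ℕ) (x : Space A) :
    (shift B)^[birkN A k m x] (h ((shift A)^[m] x)) = (shift B)^[birkN A l m x] (h x) := by
  induction m with
  | zero => rfl
  | succ m ih =>
    rw [birkN_succ, birkN_succ, Function.iterate_succ_apply', Function.iterate_add_apply, horb,
      ← Function.iterate_add_apply, add_comm, Function.iterate_add_apply, ih,
      ← Function.iterate_add_apply, add_comm]

lemma birk_psi
    (horb : ∀ x, (shift B)^[k x] (h (shift A x)) = (shift B)^[l x] (h x))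
    (f : Space B → ℤ) (m : ℕ) (x : Space A) :
    birk A (psi A B h l k f) m x
      = birk B f (birkN A l m x) (h x) - birk B f (birkN A k m x) (h ((shift A)^[m] x)) := by
  induction m with
  | zero => simp [birk, birkN]
  | succ m ih =>
    rw [birk_add, birk_one, ih, psi_eq_birk, birkN_succ, birkN_succ, birk_add,
      ← iterate_birkN_orbit horb, add_comm (birkN A k m x), birk_add,
      Function.iterate_succ_apply', horb]
    have h₁ := birk_add B f (birkN A k m x) (l ((shift A)^[m] x)) (h ((shift A)^[m] x))
    rw [add_comm, birk_add] at h₁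
    linarith

end Cocycle

lemma birk_sub_birk_of_not_preperiodic {A : Matrix (Fin N) (Fin N) ℤ} (g : Space A → ℤ)
    {x w : Space A} (hx : ∀ p q, (shift A)^[p] x = (shift A)^[q] x → p = q) {a b c d : ℕ}
    (hab : (shift A)^[b] w = (shift A)^[a] x) (hcd : (shift A)^[d] w = (shift A)^[c] x) :
    birk A g a x - birk A g b w = birk A g c x - birk A g d w := by
  wlog hbd : b ≤ d generalizing a b c d
  · exact (this hcd hab (le_of_not_ge hbd)).symm
  obtain ⟨e, rfl⟩ := Nat.exists_eq_add_of_le hbd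
  obtain rfl : a + e = c := hx _ _ <| by
    rw [← hcd, add_comm a, add_comm b, Function.iterate_add_apply, Function.iterate_add_apply, hab]
  rw [birk_add, birk_add, hab]
  ring

lemma psi_psi_of_not_preperiodic {A : Matrix (Fin N) (Fin N) ℤ} {B : Matrix (Fin M) (Fin M) ℤ}
    {h : Space A → Space B} {h' : Space B → Space A} {k1 l1 : Space A → ℕ} {k2 l2 : Space B → ℕ}
    (hh : ∀ x, h' (h x) = x)
    (horb1 : ∀ x, (shift B)^[k1 x] (h (shift A x)) = (shift B)^[l1 x] (h x))
    (horb2 : ∀ y, (shift A)^[k2 y] (h' (shift B y)) = (shift A)^[l2 y] (h' y))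
    (g : Space A → ℤ) {x : Space A}
    (hx : ∀ p q, (shift A)^[p] x = (shift A)^[q] x → p = q) :
    psi A B h l1 k1 (psi B A h' l2 k2 g) x = g x := by
  have h₁ := iterate_birkN_orbit horb2 (l1 x) (h x)
  have h₂ := iterate_birkN_orbit horb2 (k1 x) (h (shift A x))
  rw [hh] at h₁ h₂
  rw [horb1, ← Function.iterate_succ_apply] at h₂
  have h₃ := birk_sub_birk_of_not_preperiodic g hx h₁ h₂
  rw [Nat.succ_eq_one_add, birk_add, birk_one, Function.iterate_one] at h₃
  rw [psi_eq_birk, birk_psi horb2, birk_psi horb2, hh, hh, horb1]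
  linarith

section Density

variable {A : Matrix (Fin N) (Fin N) ℤ}

/-- The point of `X_A` obtained by prepending the symbol `i`. -/
def prepend (i : Fin N) (z : Space A) (hz : A i (z.1 0) = 1) : Space A :=
  ⟨fun n => Nat.casesOn n i z.1, fun n => by cases n with
    | zero => exact hz
    | succ n => exact z.2 n⟩

lemma shift_prepend (i : Fin N) (z : Space A) (hz : A i (z.1 0) = 1) :
    shift A (prepend i z hz) = z :=
  rfl

lemma exists_row_eq_one (h01 : IsZeroOne A) (hirr : IsIrreducible A) (i : Fin N) :
    ∃ j, A i j = 1 := by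
  obtain ⟨m, hm, hne⟩ := hirr i i
  obtain ⟨m, rfl⟩ := Nat.exists_eq_add_of_lt hm
  rw [zero_add, pow_succ', Matrix.mul_apply] at hne
  obtain ⟨j, -, hj⟩ := Finset.exists_ne_zero_of_sum_ne_zero hne
  exact ⟨j, (h01 i j).resolve_left (left_ne_zero_of_mul hj)⟩

lemma exists_col_eq_one (h01 : IsZeroOne A) (hirr : IsIrreducible A) (j : Fin N) :
    ∃ i, A i j = 1 := by
  obtain ⟨m, hm, hne⟩ := hirr j j
  obtain ⟨m, rfl⟩ := Nat.exists_eq_add_of_lt hm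
  rw [zero_add, pow_succ, Matrix.mul_apply] at hne
  obtain ⟨i, -, hi⟩ := Finset.exists_ne_zero_of_sum_ne_zero hne
  exact ⟨i, (h01 i j).resolve_left (right_ne_zero_of_mul hi)⟩

lemma exists_branching (h01 : IsZeroOne A) (hirr : IsIrreducible A)
    (hnp : ¬ IsPermutationMatrix A) :
    ∃ i j j', j ≠ j' ∧ A i j = 1 ∧ A i j' = 1 := by
  by_contra! hcon
  choose e he using exists_row_eq_one h01 hirr
  have huniq : ∀ i j, A i j = 1 → e i = j := fun i j hij => by
    by_contra hne
    exact hcon i _ _ hne (he i) hij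
  have hsurj : Function.Surjective e := fun j =>
    (exists_col_eq_one h01 hirr j).imp fun i hi => huniq i j hi
  refine hnp ⟨Equiv.ofBijective e (Finite.surjective_iff_bijective.1 hsurj), fun i j => ?_⟩
  rw [Equiv.ofBijective_apply]
  split_ifs with hij
  · exact hij ▸ he i
  · exact (h01 i j).resolve_right fun hA => hij (huniq i j hA)

lemma exists_point_from (h01 : IsZeroOne A) (hirr : IsIrreducible A) (i : Fin N) :
    ∃ z : Space A, z.1 0 = i := by
  choose e he using exists_row_eq_one h01 hirr
  refine ⟨⟨fun n => e^[n] i, fun n => ?_⟩, rfl⟩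
  simpa only [Function.iterate_succ_apply'] using he (e^[n] i)

lemma exists_ne_from (h01 : IsZeroOne A) (hirr : IsIrreducible A)
    (hnp : ¬ IsPermutationMatrix A) (i : Fin N) :
    ∃ z z' : Space A, z ≠ z' ∧ z.1 0 = i ∧ z'.1 0 = i := by
  obtain ⟨i₀, j, j', hne, hj, hj'⟩ := exists_branching h01 hirr hnp
  obtain ⟨m, -, hm⟩ := hirr i i₀
  induction m generalizing i with
  | zero =>
    obtain rfl : i = i₀ := by
      by_contra hi
      exact hm (by rw [pow_zero, Matrix.one_apply_ne hi])
    obtain ⟨z, rfl⟩ := exists_point_from h01 hirr j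
    obtain ⟨z', rfl⟩ := exists_point_from h01 hirr j'
    refine ⟨prepend i z hj, prepend i z' hj', fun heq => hne ?_, rfl, rfl⟩
    have := congrArg (shift A) heq
    rw [shift_prepend, shift_prepend] at this
    rw [this]
  | succ m ih =>
    rw [pow_succ', Matrix.mul_apply] at hm
    obtain ⟨i', -, hi'⟩ := Finset.exists_ne_zero_of_sum_ne_zero hm
    have hA := (h01 i i').resolve_left (left_ne_zero_of_mul hi')
    obtain ⟨z, z', hzz, rfl, hz'⟩ := ih i' (right_ne_zero_of_mul hi')
    refine ⟨prepend i z hA, prepend i z' (hz' ▸ hA), fun heq => hzz ?_, rfl, rfl⟩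
    exact congrArg (shift A) heq

lemma exists_ne_agreeing (h01 : IsZeroOne A) (hirr : IsIrreducible A)
    (hnp : ¬ IsPermutationMatrix A) (n : ℕ) (x : Space A) :
    ∃ y : Space A, y ≠ x ∧ ∀ i ≤ n, y.1 i = x.1 i := by
  induction n generalizing x with
  | zero =>
    obtain ⟨z, z', hne, hz, hz'⟩ := exists_ne_from h01 hirr hnp (x.1 0)
    by_cases hzx : z = x
    · exact ⟨z', fun heq => hne (hzx.trans heq.symm), fun i hi => by
        rw [Nat.le_zero.1 hi, hz']⟩
    · exact ⟨z, hzx, fun i hi => by rw [Nat.le_zero.1 hi, hz]⟩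
  | succ n ih =>
    obtain ⟨y, hne, hy⟩ := ih (shift A x)
    have hA : A (x.1 0) (y.1 0) = 1 := by
      rw [hy 0 (Nat.zero_le n)]
      exact x.2 0
    refine ⟨prepend (x.1 0) y hA, fun heq => hne (congrArg (shift A) heq), fun i hi => ?_⟩
    cases i with
    | zero => rfl
    | succ i => exact hy i (Nat.le_of_succ_le_succ hi)

open Filter Topology in
lemma nhdsNE_neBot (h01 : IsZeroOne A) (hirr : IsIrreducible A)
    (hnp : ¬ IsPermutationMatrix A) (x : Space A) : (𝓝[≠] x).NeBot := by
  choose y hne hy using fun n => exists_ne_agreeing h01 hirr hnp n x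
  have hlim : Tendsto y atTop (𝓝 x) := by
    rw [tendsto_subtype_rng, tendsto_pi_nhds]
    intro i
    refine tendsto_const_nhds.congr' ?_
    filter_upwards [eventually_ge_atTop i] with n hn
    exact (hy n i hn).symm
  exact (tendsto_nhdsWithin_iff.2 ⟨hlim, Eventually.of_forall hne⟩).neBot

instance (A : Matrix (Fin N) (Fin N) ℤ) : CompactSpace (Space A) := by
  have hclosed : IsClosed {x : ℕ → Fin N | ∀ n, A (x n) (x (n + 1)) = 1} := by
    rw [Set.ofPred_forall]
    refine isClosed_iInter fun n => ?_
    have hA : Continuous fun p : Fin N × Fin N => A p.1 p.2 := continuous_of_discreteTopology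
    have hn : Continuous fun x : ℕ → Fin N => (x n, x (n + 1)) := by fun_prop
    have hAn : Continuous fun x : ℕ → Fin N => A (x n) (x (n + 1)) := hA.comp hn
    exact isClosed_eq hAn continuous_const
  exact isCompact_iff_compactSpace.1 hclosed.isCompact

lemma shift_iterate_apply (m : ℕ) (x : Space A) (n : ℕ) :
    ((shift A)^[m] x).1 n = x.1 (n + m) := by
  induction m generalizing x with
  | zero => rfl
  | succ m ih =>
    rw [Function.iterate_succ_apply, ih]
    rfl

lemma countable_iterate_eq {p q : ℕ} (hpq : p < q) :
    {x : Space A | (shift A)^[p] x = (shift A)^[q] x}.Countable := by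
  have hinj : Set.InjOn (fun (x : Space A) (i : Fin q) => x.1 i)
      {x : Space A | (shift A)^[p] x = (shift A)^[q] x} := by
    intro x hx y hy hxy
    refine Subtype.ext (funext fun n => ?_)
    induction n using Nat.strong_induction_on with
    | _ n ih =>
      rcases lt_or_ge n q with hn | hn
      · exact congrFun hxy ⟨n, hn⟩
      · obtain ⟨e, rfl⟩ := Nat.exists_eq_add_of_le' hn
        have hx' := congrArg (fun z : Space A => z.1 e) hx
        have hy' := congrArg (fun z : Space A => z.1 e) hy
        simp only [shift_iterate_apply] at hx' hy'
        rw [← hx', ← hy', ih _ (by lia)]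
  exact Set.MapsTo.countable_of_injOn (Set.mapsTo_univ _ _) hinj (Set.to_countable _)

lemma countable_preperiodic :
    {x : Space A | ∃ p q, (shift A)^[p] x = (shift A)^[q] x ∧ p ≠ q}.Countable := by
  refine (Set.countable_iUnion fun r : {r : ℕ × ℕ // r.1 < r.2} =>
    countable_iterate_eq (A := A) r.2).mono ?_
  rintro x ⟨p, q, heq, hne⟩
  rw [Set.mem_iUnion]
  rcases lt_or_gt_of_ne hne with hlt | hlt
  · exact ⟨⟨(p, q), hlt⟩, heq⟩
  · exact ⟨⟨(q, p), hlt⟩, heq.symm⟩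

lemma dense_not_preperiodic (h01 : IsZeroOne A) (hirr : IsIrreducible A)
    (hnp : ¬ IsPermutationMatrix A) :
    Dense {x : Space A | ∀ p q, (shift A)^[p] x = (shift A)^[q] x → p = q} := by
  have hd := dense_biInter_of_isOpen (f := fun x : Space A => ({x}ᶜ : Set (Space A)))
    (fun _ _ => isOpen_compl_singleton) (countable_preperiodic (A := A))
    (fun x _ => have := nhdsNE_neBot h01 hirr hnp x; dense_compl_singleton x)
  refine hd.mono fun x hx p q heq => ?_
  by_contra hne
  exact Set.mem_iInter₂.1 hx x ⟨p, q, heq, hne⟩ rfl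

end Density

lemma continuous_birk (A : Matrix (Fin N) (Fin N) ℤ) {X : Type*} [TopologicalSpace X]
    {f : Space A → ℤ} (hf : Continuous f) {n : X → ℕ} (hn : Continuous n) {u : X → Space A}
    (hu : Continuous u) : Continuous fun x => birk A f (n x) (u x) := by
  have hc : Continuous fun p : ℕ × Space A => birk A f p.1 p.2 :=
    continuous_prod_of_discrete_left.2 fun m =>
      continuous_finsetSum (Finset.range m) fun i _ => hf.comp ((continuous_shift A).iterate i)
  exact hc.comp (hn.prodMk hu)

lemma continuous_psi (A : Matrix (Fin N) (Fin N) ℤ) (B : Matrix (Fin M) (Fin M) ℤ)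
    {h : Space A → Space B} {l k : Space A → ℕ} {f : Space B → ℤ} (hh : Continuous h)
    (hl : Continuous l) (hk : Continuous k) (hf : Continuous f) :
    Continuous (psi A B h l k f) :=
  (continuous_birk B hf hl hh).sub (continuous_birk B hf hk (hh.comp (continuous_shift A)))

/-- `Ψ_h ∘ Ψ_{h⁻¹}` is the identity on `C(X_A, ℤ)`. -/
lemma psi_psi_symm {A : Matrix (Fin N) (Fin N) ℤ} {B : Matrix (Fin M) (Fin M) ℤ}
    (h01 : IsZeroOne A) (hirr : IsIrreducible A) (hnp : ¬ IsPermutationMatrix A)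
    {h : Space A ≃ₜ Space B} {k1 l1 : C(Space A, ℕ)} {k2 l2 : C(Space B, ℕ)}
    (horb : OrbitEqFns A B h k1 l1 k2 l2) (g : C(Space A, ℤ)) :
    psi A B h l1 k1 (psi B A h.symm l2 k2 g) = g :=
  Continuous.ext_on (dense_not_preperiodic h01 hirr hnp)
    (continuous_psi A B h.continuous l1.continuous k1.continuous
      (continuous_psi B A h.symm.continuous l2.continuous k2.continuous g.continuous))
    g.continuous
    fun _ hx => psi_psi_of_not_preperiodic h.symm_apply_apply horb.1 horb.2 g hx

theorem psi_birkhoff_formulas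
    {N M : ℕ} (A : Matrix (Fin N) (Fin N) ℤ) (B : Matrix (Fin M) (Fin M) ℤ)
    (hN : 1 < N) (hM : 1 < M) (hA01 : IsZeroOne A) (hB01 : IsZeroOne B)
    (hAirr : IsIrreducible A) (hBirr : IsIrreducible B)
    (hAnp : ¬ IsPermutationMatrix A) (hBnp : ¬ IsPermutationMatrix B)
    (h : Space A ≃ₜ Space B) (k1 l1 : C(Space A, ℕ)) (k2 l2 : C(Space B, ℕ))
    (horb : OrbitEqFns A B h k1 l1 k2 l2)
    (m : ℕ) (f : C(Space B, ℤ)) (g : C(Space A, ℤ)) :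
    (∀ x : Space A,
      birk A (psi A B (⇑h) (⇑l1) (⇑k1) (⇑f)) m x
        = birk B (⇑f) (birkN A (⇑l1) m x) (h x)
          - birk B (⇑f) (birkN A (⇑k1) m x) (h ((shift A)^[m] x)) ∧
      birk A (⇑g) m x
        = birk B (psi B A (⇑h.symm) (⇑l2) (⇑k2) (⇑g)) (birkN A (⇑l1) m x) (h x)
          - birk B (psi B A (⇑h.symm) (⇑l2) (⇑k2) (⇑g)) (birkN A (⇑k1) m x) (h ((shift A)^[m] x))) ∧
    (∀ y : Space B,
      birk B (psi B A (⇑h.symm) (⇑l2) (⇑k2) (⇑g)) m y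
        = birk A (⇑g) (birkN B (⇑l2) m y) (h.symm y)
          - birk A (⇑g) (birkN B (⇑k2) m y) (h.symm ((shift B)^[m] y)) ∧
      birk B (⇑f) m y
        = birk A (psi A B (⇑h) (⇑l1) (⇑k1) (⇑f)) (birkN B (⇑l2) m y) (h.symm y)
          - birk A (psi A B (⇑h) (⇑l1) (⇑k1) (⇑f)) (birkN B (⇑k2) m y) (h.symm ((shift B)^[m] y))) := by
  have hA := psi_psi_symm hA01 hAirr hAnp horb g
  have hB : psi B A h.symm l2 k2 (psi A B h l1 k1 f) = f :=
    psi_psi_symm (h := h.symm) hB01 hBirr hBnp ⟨horb.2, horb.1⟩ f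
  refine ⟨fun x => ⟨birk_psi horb.1 f m x, ?_⟩, fun y => ⟨birk_psi horb.2 g m y, ?_⟩⟩
  · rw [← birk_psi horb.1, hA]
  · rw [← birk_psi horb.2, hB]

end OneSidedMarkov
end
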